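/- Let a > 0 and let ν satisfy −1/2 < ν < 1/2. Then ∫_0^∞ K_ν(a x)² dx = π²/(4a cos(πν)). -/

import Mathlib

open MeasureTheory Filter Set

theorem abs_integral_cos_mul_exp_neg_mul_sq_le {u T : ℝ} (hu : 0 ≤ u) (hT : 0 ≤ T) :
    |∫ t in (0:ℝ)..T, Real.cos t * Real.exp (-(u * t ^ 2))| ≤ 1 := by
  have hderiv (t : ℝ) : HasDerivAt (fun t => Real.exp (-(u * t ^ 2)))
      (-(2 * u * t * Real.exp (-(u * t ^ 2)))) t := by
    have h := (((hasDerivAt_id t).pow 2).const_mul u).neg.exp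
    convert! h using 1
    simp
    ring
  have hint : IntervalIntegrable (fun t => -(2 * u * t * Real.exp (-(u * t ^ 2)))) volume 0 T :=
    (by fun_prop : Continuous _).intervalIntegrable _ _
  have hparts := intervalIntegral.integral_mul_deriv_eq_deriv_mul (a := 0) (b := T)
    (fun t _ => hderiv t) (fun t _ => Real.hasDerivAt_sin t) hint
    (Real.continuous_cos.intervalIntegrable _ _)
  have hmain : ∫ t in (0:ℝ)..T, Real.cos t * Real.exp (-(u * t ^ 2)) =
      Real.exp (-(u * T ^ 2)) * Real.sin T +
        ∫ t in (0:ℝ)..T, 2 * u * t * Real.exp (-(u * t ^ 2)) * Real.sin t := by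
    simp_rw [mul_comm (Real.cos _)]
    rw [hparts]
    simp
  have htail : |∫ t in (0:ℝ)..T, 2 * u * t * Real.exp (-(u * t ^ 2)) * Real.sin t| ≤
      1 - Real.exp (-(u * T ^ 2)) := by
    have hFTC : ∫ t in (0:ℝ)..T, 2 * u * t * Real.exp (-(u * t ^ 2)) =
        1 - Real.exp (-(u * T ^ 2)) := by
      have h := intervalIntegral.integral_eq_sub_of_hasDerivAt (fun t _ => hderiv t) hint
      rw [intervalIntegral.integral_neg] at h
      simp at h
      linarith
    rw [← hFTC, ← Real.norm_eq_abs]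
    refine intervalIntegral.norm_integral_le_of_norm_le hT (.of_forall fun t ht => ?_)
      ((by fun_prop : Continuous _).intervalIntegrable _ _)
    have h0 : 0 ≤ 2 * u * t * Real.exp (-(u * t ^ 2)) := by
      have := ht.1
      positivity
    rw [Real.norm_eq_abs, abs_mul, abs_of_nonneg h0]
    exact mul_le_of_le_one_right h0 (Real.abs_sin_le_one t)
  have hsin : |Real.exp (-(u * T ^ 2)) * Real.sin T| ≤ Real.exp (-(u * T ^ 2)) := by
    rw [abs_mul, Real.abs_exp]
    exact mul_le_of_le_one_right (Real.exp_pos _).le (Real.abs_sin_le_one T)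
  rw [hmain]
  exact (abs_add_le _ _).trans (by linarith)

theorem integral_Ioi_cos_mul_exp_neg_mul_sq {u : ℝ} (hu : 0 < u) :
    ∫ t in Ioi (0:ℝ), Real.cos t * Real.exp (-(u * t ^ 2)) =
      1 / 2 * (√(Real.pi / u) * Real.exp (-(4 * u)⁻¹)) := by
  have hline : ∫ t : ℝ, Real.cos t * Real.exp (-(u * t ^ 2)) =
      √(Real.pi / u) * Real.exp (-(4 * u)⁻¹) := by
    have h := fourierIntegral_gaussian (b := (u : ℂ)) (by simpa using hu) 1
    have hre := congrArg Complex.re h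
    have hint : Integrable fun t : ℝ =>
        Complex.exp (Complex.I * 1 * t) * Complex.exp (-(u : ℂ) * (t : ℂ) ^ 2) := by
      have := integrable_cexp_quadratic (b := (u : ℂ)) (by simpa using hu) Complex.I 0
      refine this.congr (.of_forall fun t => ?_)
      simp only [← Complex.exp_add]
      ring_nf
    rw [← RCLike.re_eq_complex_re, ← integral_re hint] at hre
    convert! hre using 1
    · refine integral_congr_ae (.of_forall fun t => ?_)
      simp only [RCLike.re_eq_complex_re, mul_one]
      rw [show Complex.I * (t : ℂ) = (t : ℂ) * Complex.I by ring,
        show -(u : ℂ) * (t : ℂ) ^ 2 = ((-(u * t ^ 2) : ℝ) : ℂ) by push_cast; ring,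
        ← Complex.ofReal_exp, Complex.re_mul_ofReal, Complex.exp_ofReal_mul_I_re]
    · rw [Real.sqrt_eq_rpow, RCLike.re_eq_complex_re,
        show ((Real.pi : ℂ) / (u : ℂ)) ^ (1 / 2 : ℂ) = (((Real.pi / u) ^ (1 / 2 : ℝ) : ℝ) : ℂ) by
          rw [Complex.ofReal_cpow (by positivity)]; push_cast; rfl,
        show -1 ^ 2 / (4 * (u : ℂ)) = ((-(4 * u)⁻¹ : ℝ) : ℂ) by push_cast; ring,
        ← Complex.ofReal_exp, ← Complex.ofReal_mul, Complex.ofReal_re]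
  have h := integral_comp_abs (f := fun t => Real.cos t * Real.exp (-(u * t ^ 2)))
  simp only [Real.cos_abs, sq_abs] at h
  linarith

theorem integrable_cos_mul_exp_neg_mul_sq {u : ℝ} (hu : 0 < u) :
    Integrable fun t : ℝ => Real.cos t * Real.exp (-(u * t ^ 2)) := by
  have h := integrable_exp_neg_mul_sq hu
  simp only [neg_mul] at h
  refine h.bdd_mul (c := 1) (by fun_prop) (.of_forall fun t => ?_)
  simpa using Real.abs_cos_le_one t

theorem integrableOn_rpow_mul_exp_neg_mul {s r : ℝ} (hs : 0 < s) (hr : 0 < r) :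
    IntegrableOn (fun u : ℝ => u ^ (s - 1) * Real.exp (-(r * u))) (Ioi 0) := by
  simpa using integrableOn_rpow_mul_exp_neg_mul_rpow (p := 1) (s := s - 1) (b := r)
    (by linarith) one_pos hr

theorem Gamma_mul_integral_cos_div_rpow {s x T : ℝ} (hs : 0 < s) (hx : 0 < x) :
    Real.Gamma s * ∫ t in (0:ℝ)..T, Real.cos t / (x ^ 2 + t ^ 2) ^ s =
      ∫ u in Ioi (0:ℝ), u ^ (s - 1) * Real.exp (-(x ^ 2 * u)) *
        ∫ t in (0:ℝ)..T, Real.cos t * Real.exp (-(u * t ^ 2)) := by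
  have hswap := intervalIntegral_integral_swap (a := 0) (b := T) (μ := volume.restrict (Ioi (0:ℝ)))
    (f := fun t u => u ^ (s - 1) * Real.exp (-(x ^ 2 * u)) *
      (Real.cos t * Real.exp (-(u * t ^ 2)))) ?_
  · rw [← intervalIntegral.integral_const_mul]
    simp_rw [← intervalIntegral.integral_const_mul]
    rw [← hswap]
    refine intervalIntegral.integral_congr fun t _ => ?_
    have hpos : 0 < x ^ 2 + t ^ 2 := by positivity
    have hG := Real.integral_rpow_mul_exp_neg_mul_Ioi hs hpos
    have : ∀ u : ℝ, u ^ (s - 1) * Real.exp (-(x ^ 2 * u)) *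
        (Real.cos t * Real.exp (-(u * t ^ 2))) =
        Real.cos t * (u ^ (s - 1) * Real.exp (-((x ^ 2 + t ^ 2) * u))) := fun u => by
      rw [show -((x ^ 2 + t ^ 2) * u) = -(x ^ 2 * u) + -(u * t ^ 2) by ring, Real.exp_add]
      ring
    simp only [this]
    rw [integral_const_mul, hG, one_div, Real.inv_rpow hpos.le]
    ring
  · have hdom : Integrable (fun p : ℝ × ℝ => (1:ℝ) * (p.2 ^ (s - 1) * Real.exp (-(x ^ 2 * p.2))))
        ((volume.restrict (uIoc 0 T)).prod (volume.restrict (Ioi (0:ℝ)))) := by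
      refine Integrable.mul_prod (f := fun _ : ℝ => (1:ℝ))
        (g := fun u : ℝ => u ^ (s - 1) * Real.exp (-(x ^ 2 * u))) ?_
        (integrableOn_rpow_mul_exp_neg_mul hs (by positivity))
      have : IsFiniteMeasure (volume.restrict (uIoc 0 T)) := ⟨by simp [uIoc]⟩
      exact integrable_const _
    refine hdom.mono' (Measurable.aestronglyMeasurable (by unfold Function.uncurry; fun_prop)) ?_
    have hpos : ∀ᵐ p : ℝ × ℝ ∂((volume.restrict (uIoc 0 T)).prod (volume.restrict (Ioi (0:ℝ)))),
        0 < p.2 :=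
      Measure.quasiMeasurePreserving_snd.ae (ae_restrict_mem measurableSet_Ioi)
    filter_upwards [hpos] with p hp
    have h0 : 0 ≤ p.2 ^ (s - 1) * Real.exp (-(x ^ 2 * p.2)) := by positivity
    simp only [Function.uncurry, Real.norm_eq_abs, one_mul]
    rw [abs_mul, abs_of_nonneg h0, abs_mul, Real.abs_exp]
    refine mul_le_of_le_one_right h0 (mul_le_one₀ (Real.abs_cos_le_one _) (Real.exp_pos _).le ?_)
    rw [Real.exp_le_one_iff]
    have : 0 ≤ p.2 * p.1 ^ 2 := by positivity
    linarith

theorem gaussian_limit_eq {ν x u : ℝ} (hu : 0 < u) :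
    u ^ (ν + 1 / 2 - 1) * Real.exp (-(x ^ 2 * u)) *
        (1 / 2 * (√(Real.pi / u) * Real.exp (-(4 * u)⁻¹))) =
      √Real.pi / 2 * (u ^ (ν - 1) * Real.exp (-(x ^ 2 * u + (4 * u)⁻¹))) := by
  rw [show ν + 1 / 2 - 1 = (ν - 1) + 1 / 2 by ring, Real.rpow_add hu, ← Real.sqrt_eq_rpow,
    Real.sqrt_div Real.pi_pos.le, neg_add, Real.exp_add]
  have : √u ≠ 0 := (Real.sqrt_pos.2 hu).ne'
  field_simp

/-- The integrand of `2 * K_ν(x) = ∫ w in (0, ∞), w ^ (ν - 1) * exp (-x / 2 * (w + 1 / w))`. -/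
noncomputable def besselKernel (ν x w : ℝ) : ℝ :=
  w ^ (ν - 1) * Real.exp (-(x / 2 * (w + w⁻¹)))

theorem besselKernel_nonneg {w : ℝ} (ν x : ℝ) (hw : 0 < w) : 0 ≤ besselKernel ν x w := by
  unfold besselKernel
  positivity

theorem measurable_besselKernel (ν : ℝ) :
    Measurable fun p : ℝ × ℝ => besselKernel ν p.1 p.2 := by
  unfold besselKernel
  fun_prop

theorem gaussian_limit_scaled_eq {ν x w : ℝ} (hx : 0 < x) (hw : 0 < w) :
    ((2 * x)⁻¹ * w) ^ (ν - 1) *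
        Real.exp (-(x ^ 2 * ((2 * x)⁻¹ * w) + (4 * ((2 * x)⁻¹ * w))⁻¹)) =
      (2 * x) * (2 * x) ^ (-ν) * besselKernel ν x w := by
  have h2x : 0 < 2 * x := by positivity
  rw [besselKernel, Real.mul_rpow (by positivity) hw.le, Real.inv_rpow h2x.le,
    ← Real.rpow_neg h2x.le, show -(ν - 1) = 1 + -ν by ring, Real.rpow_add h2x, Real.rpow_one,
    mul_assoc]
  congr 4
  field_simp
  ring

theorem tendsto_integral_cos_mul_exp_neg_mul_sq {u : ℝ} (hu : 0 < u) :
    Tendsto (fun T => ∫ t in (0:ℝ)..T, Real.cos t * Real.exp (-(u * t ^ 2))) atTop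
      (nhds (1 / 2 * (√(Real.pi / u) * Real.exp (-(4 * u)⁻¹)))) := by
  rw [← integral_Ioi_cos_mul_exp_neg_mul_sq hu]
  exact intervalIntegral_tendsto_integral_Ioi 0
    (integrable_cos_mul_exp_neg_mul_sq hu).integrableOn tendsto_id

theorem integrableOn_gaussian_limit {ν x : ℝ} (hν : -1 / 2 < ν) (hx : 0 < x) :
    IntegrableOn (fun u : ℝ => u ^ (ν - 1) * Real.exp (-(x ^ 2 * u + (4 * u)⁻¹))) (Ioi 0) := by
  have hdom := integrableOn_rpow_mul_exp_neg_mul (s := ν + 1 / 2) (r := x ^ 2)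
    (by linarith) (by positivity)
  have h : IntegrableOn (fun u : ℝ => √Real.pi / 2 *
      (u ^ (ν - 1) * Real.exp (-(x ^ 2 * u + (4 * u)⁻¹)))) (Ioi 0) := by
    refine Integrable.mono' hdom (Measurable.aestronglyMeasurable (by fun_prop)) ?_
    filter_upwards [ae_restrict_mem measurableSet_Ioi] with u hu
    have hu : 0 < u := hu
    have hlim : |1 / 2 * (√(Real.pi / u) * Real.exp (-(4 * u)⁻¹))| ≤ 1 :=
      le_of_tendsto (tendsto_integral_cos_mul_exp_neg_mul_sq hu).abs
        ((eventually_ge_atTop 0).mono fun T hT =>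
          abs_integral_cos_mul_exp_neg_mul_sq_le hu.le hT)
    have h0 : 0 ≤ u ^ (ν + 1 / 2 - 1) * Real.exp (-(x ^ 2 * u)) := by positivity
    rw [← gaussian_limit_eq hu, Real.norm_eq_abs, abs_mul, abs_of_nonneg h0]
    exact mul_le_of_le_one_right h0 hlim
  have hpi : √Real.pi / 2 ≠ 0 := by positivity
  exact (integrable_const_mul_iff (IsUnit.mk0 _ hpi) _).1 h

theorem integrableOn_besselKernel {ν x : ℝ} (hν : -1 / 2 < ν) (hx : 0 < x) :
    IntegrableOn (besselKernel ν x) (Ioi 0) := by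
  have h2x : 0 < (2 * x)⁻¹ := by positivity
  have h := integrableOn_gaussian_limit hν hx
  rw [← mul_zero (2 * x)⁻¹, ← integrableOn_Ioi_comp_mul_left_iff _ _ h2x] at h
  have h' : IntegrableOn (fun w => (2 * x) * (2 * x) ^ (-ν) * besselKernel ν x w) (Ioi 0) :=
    h.congr_fun (fun w hw => gaussian_limit_scaled_eq hx hw) measurableSet_Ioi
  have hc : (2 * x) * (2 * x) ^ (-ν) ≠ 0 := by positivity
  exact (integrable_const_mul_iff (IsUnit.mk0 _ hc) _).1 h'

theorem integral_gaussian_limit {ν x : ℝ} (hx : 0 < x) :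
    ∫ u in Ioi (0:ℝ), u ^ (ν - 1) * Real.exp (-(x ^ 2 * u + (4 * u)⁻¹)) =
      (2 * x) ^ (-ν) * ∫ w in Ioi (0:ℝ), besselKernel ν x w := by
  have h2x : 0 < (2 * x)⁻¹ := by positivity
  have h := integral_comp_mul_left_Ioi'
    (fun u : ℝ => u ^ (ν - 1) * Real.exp (-(x ^ 2 * u + (4 * u)⁻¹))) 0 h2x
  rw [mul_zero] at h
  rw [← h, setIntegral_congr_fun measurableSet_Ioi
    (fun w hw => gaussian_limit_scaled_eq (ν := ν) hx hw), integral_const_mul, smul_eq_mul]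
  field_simp

theorem tendsto_Gamma_mul_integral_cos_div_rpow {ν x : ℝ} (hν : -1 / 2 < ν) (hx : 0 < x) :
    Tendsto (fun T => Real.Gamma (ν + 1 / 2) *
        ∫ t in (0:ℝ)..T, Real.cos t / (x ^ 2 + t ^ 2) ^ (ν + 1 / 2)) atTop
      (nhds (√Real.pi / 2 * ((2 * x) ^ (-ν) * ∫ w in Ioi (0:ℝ), besselKernel ν x w))) := by
  have hs : 0 < ν + 1 / 2 := by linarith
  simp_rw [Gamma_mul_integral_cos_div_rpow hs hx]
  rw [← integral_gaussian_limit hx, ← integral_const_mul, ← setIntegral_congr_fun measurableSet_Ioi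
    (fun u hu => gaussian_limit_eq hu)]
  refine tendsto_integral_filter_of_dominated_convergence
    (fun u => u ^ (ν + 1 / 2 - 1) * Real.exp (-(x ^ 2 * u))) (.of_forall fun T => ?_) ?_
    (integrableOn_rpow_mul_exp_neg_mul hs (by positivity)) ?_
  · have hc : Continuous fun u : ℝ => ∫ t in (0:ℝ)..T, Real.cos t * Real.exp (-(u * t ^ 2)) :=
      intervalIntegral.continuous_parametric_intervalIntegral_of_continuous' (by fun_prop) _ _
    exact (Measurable.mul (by fun_prop) hc.measurable).aestronglyMeasurable
  · filter_upwards [eventually_ge_atTop 0] with T hT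
    filter_upwards [ae_restrict_mem measurableSet_Ioi] with u hu
    have hu : 0 < u := hu
    have h0 : 0 ≤ u ^ (ν + 1 / 2 - 1) * Real.exp (-(x ^ 2 * u)) := by positivity
    rw [Real.norm_eq_abs, abs_mul, abs_of_nonneg h0]
    exact mul_le_of_le_one_right h0 (abs_integral_cos_mul_exp_neg_mul_sq_le hu.le hT)
  · filter_upwards [ae_restrict_mem measurableSet_Ioi] with u hu
    exact (tendsto_integral_cos_mul_exp_neg_mul_sq hu).const_mul _

theorem eq_half_integral_besselKernel {ν x k : ℝ} (hν : -1 / 2 < ν) (hx : 0 < x)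
    (hk : Tendsto (fun T => ∫ t in (0:ℝ)..T, Real.cos t / (x ^ 2 + t ^ 2) ^ (ν + 1 / 2)) atTop
      (nhds (√Real.pi * k / ((2 : ℝ) ^ ν * Real.Gamma (ν + 1 / 2) * x ^ ν)))) :
    k = 1 / 2 * ∫ w in Ioi (0:ℝ), besselKernel ν x w := by
  have hG : 0 < Real.Gamma (ν + 1 / 2) := Real.Gamma_pos_of_pos (by linarith)
  have h := tendsto_nhds_unique (hk.const_mul (Real.Gamma (ν + 1 / 2)))
    (tendsto_Gamma_mul_integral_cos_div_rpow hν hx)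
  rw [Real.rpow_neg (by positivity), Real.mul_rpow (by positivity) hx.le] at h
  generalize Real.Gamma (ν + 1 / 2) = g at h hG
  have h2 : 0 < (2:ℝ) ^ ν := by positivity
  have hxν : 0 < x ^ ν := by positivity
  have hpi : 0 < √Real.pi := by positivity
  field_simp at h
  linarith

theorem lintegral_Ioi_eq_mul_lintegral_comp_mul {c : ℝ} (hc : 0 < c) (g : ℝ → ENNReal) :
    ∫⁻ x in Ioi (0:ℝ), g x = ∫⁻ x in Ioi (0:ℝ), ENNReal.ofReal c * g (c * x) := by
  have h := lintegral_image_eq_lintegral_abs_deriv_mul (s := Ioi (0:ℝ)) (f := fun x => c * x)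
    (f' := fun _ => c) measurableSet_Ioi
    (fun x _ => by simpa using ((hasDerivAt_id x).const_mul c).hasDerivWithinAt)
    (fun x _ y _ hxy => mul_left_cancel₀ hc.ne' hxy) g
  rwa [image_const_mul_Ioi_zero hc, abs_of_pos hc] at h

theorem lintegral_exp_neg_mul_Ioi {c : ℝ} (hc : 0 < c) :
    ∫⁻ x in Ioi (0:ℝ), ENNReal.ofReal (Real.exp (-(c * x))) = ENNReal.ofReal c⁻¹ := by
  have h1 := Real.integral_rpow_mul_exp_neg_mul_Ioi one_pos hc
  have h2 := integrableOn_rpow_mul_exp_neg_mul one_pos hc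
  simp only [sub_self, Real.rpow_zero, one_mul, Real.rpow_one, Real.Gamma_one, mul_one,
    one_div] at h1 h2
  rw [← h1, ofReal_integral_eq_lintegral_ofReal h2 (.of_forall fun x => (Real.exp_pos _).le)]

theorem lintegral_rpow_mul_exp_neg_mul_Ioi {s r : ℝ} (hs : 0 < s) (hr : 0 < r) :
    ∫⁻ x in Ioi (0:ℝ), ENNReal.ofReal (x ^ (s - 1) * Real.exp (-(r * x))) =
      ENNReal.ofReal (r ^ (-s) * Real.Gamma s) := by
  rw [Real.rpow_neg hr.le, ← Real.inv_rpow hr.le, ← one_div,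
    ← Real.integral_rpow_mul_exp_neg_mul_Ioi hs hr]
  refine (ofReal_integral_eq_lintegral_ofReal (integrableOn_rpow_mul_exp_neg_mul hs hr) ?_).symm
  filter_upwards [ae_restrict_mem measurableSet_Ioi] with x hx
  have hx : 0 < x := hx
  simp only [Pi.zero_apply]
  positivity

theorem lintegral_rpow_div_one_add_Ioi {s : ℝ} (hs0 : 0 < s) (hs1 : s < 1) :
    ∫⁻ p in Ioi (0:ℝ), ENNReal.ofReal (p ^ (s - 1) / (1 + p)) =
      ENNReal.ofReal (Real.pi / Real.sin (Real.pi * s)) := by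
  calc ∫⁻ p in Ioi (0:ℝ), ENNReal.ofReal (p ^ (s - 1) / (1 + p))
      = ∫⁻ p in Ioi (0:ℝ), ∫⁻ y in Ioi (0:ℝ),
          ENNReal.ofReal (p ^ (s - 1) * Real.exp (-((1 + p) * y))) := by
        refine setLIntegral_congr_fun measurableSet_Ioi fun p hp => ?_
        have hp : 0 < p := hp
        have h0 : 0 ≤ p ^ (s - 1) := by positivity
        simp_rw [ENNReal.ofReal_mul h0]
        rw [lintegral_const_mul _ (by fun_prop), lintegral_exp_neg_mul_Ioi (by positivity),
          ← ENNReal.ofReal_mul h0, div_eq_mul_inv]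
    _ = ∫⁻ y in Ioi (0:ℝ), ∫⁻ p in Ioi (0:ℝ),
          ENNReal.ofReal (p ^ (s - 1) * Real.exp (-((1 + p) * y))) :=
        lintegral_lintegral_swap (Measurable.aemeasurable (by unfold Function.uncurry; fun_prop))
    _ = ∫⁻ y in Ioi (0:ℝ), ENNReal.ofReal (Real.Gamma s) *
          ENNReal.ofReal (y ^ (1 - s - 1) * Real.exp (-(1 * y))) := by
        refine setLIntegral_congr_fun measurableSet_Ioi fun y hy => ?_
        have hy : 0 < y := hy
        have h0 := (Real.Gamma_pos_of_pos hs0).le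
        have (p : ℝ) : ENNReal.ofReal (p ^ (s - 1) * Real.exp (-((1 + p) * y))) =
            ENNReal.ofReal (Real.exp (-y)) *
              ENNReal.ofReal (p ^ (s - 1) * Real.exp (-(y * p))) := by
          rw [← ENNReal.ofReal_mul (Real.exp_pos _).le,
            show -((1 + p) * y) = -y + -(y * p) by ring, Real.exp_add]
          ring_nf
        simp_rw [this]
        rw [lintegral_const_mul _ (by fun_prop), lintegral_rpow_mul_exp_neg_mul_Ioi hs0 hy,
          ← ENNReal.ofReal_mul (Real.exp_pos _).le, ← ENNReal.ofReal_mul h0]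
        ring_nf
    _ = ENNReal.ofReal (Real.pi / Real.sin (Real.pi * s)) := by
        rw [lintegral_const_mul _ (by fun_prop),
          lintegral_rpow_mul_exp_neg_mul_Ioi (by linarith) one_pos,
          ← ENNReal.ofReal_mul (Real.Gamma_pos_of_pos hs0).le, Real.one_rpow, one_mul,
          Real.Gamma_mul_Gamma_one_sub]

theorem lintegral_inv_sq_add_Ioi {p : ℝ} (hp : 0 < p) :
    ∫⁻ w in Ioi (0:ℝ), ENNReal.ofReal (w ^ 2 + p)⁻¹ =
      ENNReal.ofReal (Real.pi / 2 * p ^ (-(1 / 2) : ℝ)) := by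
  have hq : 0 < √p := Real.sqrt_pos.2 hp
  have hbase : ∫⁻ w in Ioi (0:ℝ), ENNReal.ofReal (1 + w ^ 2)⁻¹ = ENNReal.ofReal (Real.pi / 2) := by
    rw [← ofReal_integral_eq_lintegral_ofReal integrable_inv_one_add_sq.integrableOn
      (.of_forall fun x => by positivity), integral_Ioi_inv_one_add_sq]
    simp
  have hscale (w : ℝ) : ENNReal.ofReal √p * ENNReal.ofReal ((√p * w) ^ 2 + p)⁻¹ =
      ENNReal.ofReal (√p)⁻¹ * ENNReal.ofReal (1 + w ^ 2)⁻¹ := by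
    rw [← ENNReal.ofReal_mul hq.le, ← ENNReal.ofReal_mul (by positivity)]
    congr 1
    rw [mul_pow, Real.sq_sqrt hp.le]
    have : 0 < 1 + w ^ 2 := by positivity
    rw [show p * w ^ 2 + p = √p * √p * (1 + w ^ 2) by rw [Real.mul_self_sqrt hp.le]; ring]
    field_simp
  rw [lintegral_Ioi_eq_mul_lintegral_comp_mul hq]
  simp_rw [hscale]
  rw [lintegral_const_mul _ (by fun_prop), hbase, ← ENNReal.ofReal_mul (by positivity),
    Real.rpow_neg hp.le, ← Real.sqrt_eq_rpow, mul_comm]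

theorem lintegral_besselKernel_mul_besselKernel {w v : ℝ} (ν : ℝ) (hw : 0 < w) (hv : 0 < v) :
    ∫⁻ x in Ioi (0:ℝ), ENNReal.ofReal (besselKernel ν x w) * ENNReal.ofReal (besselKernel ν x v) =
      ENNReal.ofReal (2 * (w * v) ^ ν / ((w + v) * (1 + w * v))) := by
  have h0 : 0 ≤ (w * v) ^ (ν - 1) := by positivity
  have hc : 0 < (w + w⁻¹ + (v + v⁻¹)) / 2 := by positivity
  have (x : ℝ) : ENNReal.ofReal (besselKernel ν x w) * ENNReal.ofReal (besselKernel ν x v) =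
      ENNReal.ofReal ((w * v) ^ (ν - 1)) *
        ENNReal.ofReal (Real.exp (-((w + w⁻¹ + (v + v⁻¹)) / 2 * x))) := by
    rw [← ENNReal.ofReal_mul (besselKernel_nonneg ν x hw), ← ENNReal.ofReal_mul h0,
      Real.mul_rpow hw.le hv.le, besselKernel, besselKernel,
      show -((w + w⁻¹ + (v + v⁻¹)) / 2 * x) = -(x / 2 * (w + w⁻¹)) + -(x / 2 * (v + v⁻¹)) by ring,
      Real.exp_add]
    ring_nf
  simp_rw [this]
  rw [lintegral_const_mul _ (by fun_prop), lintegral_exp_neg_mul_Ioi hc, ← ENNReal.ofReal_mul h0,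
    Real.rpow_sub_one (by positivity)]
  congr 1
  field_simp
  ring

theorem lintegral_lintegral_besselKernel_product {ν : ℝ} (hν1 : -1 / 2 < ν) (hν2 : ν < 1 / 2) :
    ∫⁻ w in Ioi (0:ℝ), ∫⁻ v in Ioi (0:ℝ),
        ENNReal.ofReal (2 * (w * v) ^ ν / ((w + v) * (1 + w * v))) =
      ENNReal.ofReal (Real.pi ^ 2 / Real.cos (Real.pi * ν)) := by
  calc _ = ∫⁻ w in Ioi (0:ℝ), ∫⁻ p in Ioi (0:ℝ),
          ENNReal.ofReal (2 * p ^ ν / (1 + p)) * ENNReal.ofReal (w ^ 2 + p)⁻¹ := by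
        refine setLIntegral_congr_fun measurableSet_Ioi fun w hw => ?_
        have hw : 0 < w := hw
        rw [lintegral_Ioi_eq_mul_lintegral_comp_mul (inv_pos.2 hw)]
        refine setLIntegral_congr_fun measurableSet_Ioi fun p hp => ?_
        have hp : 0 < p := hp
        rw [← ENNReal.ofReal_mul (by positivity), ← ENNReal.ofReal_mul (by positivity),
          mul_inv_cancel_left₀ hw.ne']
        congr 1
        field_simp
    _ = ∫⁻ p in Ioi (0:ℝ), ∫⁻ w in Ioi (0:ℝ),
          ENNReal.ofReal (2 * p ^ ν / (1 + p)) * ENNReal.ofReal (w ^ 2 + p)⁻¹ :=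
        lintegral_lintegral_swap (Measurable.aemeasurable (by unfold Function.uncurry; fun_prop))
    _ = ∫⁻ p in Ioi (0:ℝ), ENNReal.ofReal Real.pi *
          ENNReal.ofReal (p ^ (ν + 1 / 2 - 1) / (1 + p)) := by
        refine setLIntegral_congr_fun measurableSet_Ioi fun p hp => ?_
        have hp : 0 < p := hp
        rw [lintegral_const_mul _ (by fun_prop), lintegral_inv_sq_add_Ioi hp,
          ← ENNReal.ofReal_mul (by positivity), ← ENNReal.ofReal_mul Real.pi_pos.le,
          show ν + 1 / 2 - 1 = ν + -(1 / 2) by ring, Real.rpow_add hp]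
        congr 1
        field_simp
    _ = _ := by
        rw [lintegral_const_mul _ (by fun_prop),
          lintegral_rpow_div_one_add_Ioi (by linarith) (by linarith),
          ← ENNReal.ofReal_mul Real.pi_pos.le,
          show Real.pi * (ν + 1 / 2) = Real.pi * ν + Real.pi / 2 by ring, Real.sin_add_pi_div_two]
        ring_nf

theorem lintegral_sq_lintegral_besselKernel {ν : ℝ} (hν1 : -1 / 2 < ν) (hν2 : ν < 1 / 2) :
    ∫⁻ x in Ioi (0:ℝ), (∫⁻ w in Ioi (0:ℝ), ENNReal.ofReal (besselKernel ν x w)) ^ 2 =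
      ENNReal.ofReal (Real.pi ^ 2 / Real.cos (Real.pi * ν)) := by
  have hm : Measurable fun p : ℝ × ℝ => ENNReal.ofReal (besselKernel ν p.1 p.2) :=
    (measurable_besselKernel ν).ennreal_ofReal
  have hsec (x : ℝ) : Measurable fun w => ENNReal.ofReal (besselKernel ν x w) :=
    hm.comp measurable_prodMk_left
  have hI : Measurable fun x => ∫⁻ w in Ioi (0:ℝ), ENNReal.ofReal (besselKernel ν x w) :=
    hm.lintegral_prod_right'
  calc _ = ∫⁻ x in Ioi (0:ℝ), ∫⁻ w in Ioi (0:ℝ), ENNReal.ofReal (besselKernel ν x w) *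
          ∫⁻ v in Ioi (0:ℝ), ENNReal.ofReal (besselKernel ν x v) := by
        refine lintegral_congr fun x => ?_
        rw [lintegral_mul_const _ (hsec x), sq]
    _ = ∫⁻ w in Ioi (0:ℝ), ∫⁻ x in Ioi (0:ℝ), ENNReal.ofReal (besselKernel ν x w) *
          ∫⁻ v in Ioi (0:ℝ), ENNReal.ofReal (besselKernel ν x v) :=
        lintegral_lintegral_swap (hm.mul (hI.comp measurable_fst)).aemeasurable
    _ = ∫⁻ w in Ioi (0:ℝ), ∫⁻ x in Ioi (0:ℝ), ∫⁻ v in Ioi (0:ℝ),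
          ENNReal.ofReal (besselKernel ν x w) * ENNReal.ofReal (besselKernel ν x v) := by
        refine lintegral_congr fun w => lintegral_congr fun x => ?_
        rw [lintegral_const_mul _ (hsec x)]
    _ = ∫⁻ w in Ioi (0:ℝ), ∫⁻ v in Ioi (0:ℝ), ∫⁻ x in Ioi (0:ℝ),
          ENNReal.ofReal (besselKernel ν x w) * ENNReal.ofReal (besselKernel ν x v) :=
        lintegral_congr fun w => lintegral_lintegral_swap
          ((hm.comp (measurable_fst.prodMk measurable_const)).mul hm).aemeasurable
    _ = ∫⁻ w in Ioi (0:ℝ), ∫⁻ v in Ioi (0:ℝ),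
          ENNReal.ofReal (2 * (w * v) ^ ν / ((w + v) * (1 + w * v))) :=
        setLIntegral_congr_fun measurableSet_Ioi fun w hw =>
          setLIntegral_congr_fun measurableSet_Ioi fun v hv =>
            lintegral_besselKernel_mul_besselKernel ν hw hv
    _ = _ := lintegral_lintegral_besselKernel_product hν1 hν2

theorem integral_sq_integral_besselKernel {ν : ℝ} (hν1 : -1 / 2 < ν) (hν2 : ν < 1 / 2) :
    ∫ x in Ioi (0:ℝ), (∫ w in Ioi (0:ℝ), besselKernel ν x w) ^ 2 =
      Real.pi ^ 2 / Real.cos (Real.pi * ν) := by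
  have hcos : 0 < Real.cos (Real.pi * ν) :=
    Real.cos_pos_of_mem_Ioo ⟨by nlinarith [Real.pi_pos], by nlinarith [Real.pi_pos]⟩
  have hm : StronglyMeasurable fun x => ∫ w in Ioi (0:ℝ), besselKernel ν x w :=
    (measurable_besselKernel ν).stronglyMeasurable.integral_prod_right'
  rw [integral_eq_lintegral_of_nonneg_ae (.of_forall fun x => sq_nonneg _)
    (hm.pow 2).aestronglyMeasurable]
  have hsq : ∫⁻ x in Ioi (0:ℝ), ENNReal.ofReal ((∫ w in Ioi (0:ℝ), besselKernel ν x w) ^ 2) =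
      ∫⁻ x in Ioi (0:ℝ), (∫⁻ w in Ioi (0:ℝ), ENNReal.ofReal (besselKernel ν x w)) ^ 2 := by
    refine setLIntegral_congr_fun measurableSet_Ioi fun x hx => ?_
    have hnonneg : ∀ w ∈ Ioi (0:ℝ), 0 ≤ besselKernel ν x w := fun w hw =>
      besselKernel_nonneg ν x hw
    rw [ENNReal.ofReal_pow (setIntegral_nonneg measurableSet_Ioi hnonneg),
      ofReal_integral_eq_lintegral_ofReal (integrableOn_besselKernel hν1 hx)
        ((ae_restrict_mem measurableSet_Ioi).mono hnonneg)]
  rw [hsq, lintegral_sq_lintegral_besselKernel hν1 hν2, ENNReal.toReal_ofReal (by positivity)]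

theorem stmt_19 (K : ℝ → ℝ → ℝ)
    (hK : ∀ ν : ℝ, -1/2 < ν → ∀ x : ℝ, 0 < x →
      Tendsto (fun T => ∫ t in (0:ℝ)..T, Real.cos t / (x ^ 2 + t ^ 2) ^ (ν + 1/2))
        atTop
        (nhds (Real.sqrt Real.pi * K ν x /
          ((2 : ℝ) ^ ν * Real.Gamma (ν + 1/2) * x ^ ν))))
    (a ν : ℝ) (ha : 0 < a) (hν1 : -1/2 < ν) (hν2 : ν < 1/2) :
    ∫ x in Ioi (0:ℝ), K ν (a * x) ^ 2 =
      Real.pi ^ 2 / (4 * a * Real.cos (Real.pi * ν)) := by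
  have hcongr : ∫ x in Ioi (0:ℝ), K ν x ^ 2 =
      ∫ x in Ioi (0:ℝ), 1 / 4 * (∫ w in Ioi (0:ℝ), besselKernel ν x w) ^ 2 := by
    refine setIntegral_congr_fun measurableSet_Ioi fun x hx => ?_
    rw [eq_half_integral_besselKernel hν1 hx (hK ν hν1 x hx)]
    ring
  rw [integral_comp_mul_left_Ioi (fun x => K ν x ^ 2) 0 ha, mul_zero, hcongr, integral_const_mul,
    integral_sq_integral_besselKernel hν1 hν2, smul_eq_mul]
  field_simp
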